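/- Let n ≥ 1, let q ≥ 7 be a prime power, and let S be a set of points of PG(n,q) such that every line of PG(n,q) intersects S in at most 2 or in at least q points. Then either |S| ≤ 2q^{n-1} + θ_{n-2}, or the complement of S is contained in a hyperplane of PG(n,q). -/

import Mathlib

open scoped Classical

noncomputable section

namespace PGCode

open Projectivization

/-- The points of `PG(n, q)`, where the field `F` has order `q`. -/
abbrev Pt (F : Type) [Field F] (n : ℕ) := Projectivization F (Fin (n + 1) → F)

variable {F : Type} [Field F]

/-- A point of `PG(n,q)` lies in the projective subspace determined by a linear subspace `W`. -/
def ptIn {n : ℕ} (P : Pt F n) (W : Submodule F (Fin (n + 1) → F)) : Prop :=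
  Projectivization.submodule P ≤ W

/-- The set of points of the projective subspace determined by a linear subspace `W`. -/
def ptsIn {n : ℕ} (W : Submodule F (Fin (n + 1) → F)) : Set (Pt F n) :=
  {P | ptIn P W}

/-- The incidence vector (over `F_p = ZMod p`) of the projective subspace determined by `W`. -/
def incVec (p : ℕ) {n : ℕ} (W : Submodule F (Fin (n + 1) → F)) : Pt F n → ZMod p :=
  fun P => if ptIn P W then (1 : ZMod p) else 0

/-- The code `C_{n-1}(n,q)`: the `F_p`-span of the incidence vectors of all hyperplanes
(projective dimension `n-1`, i.e. linear dimension `n`). -/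
def code (F : Type) [Field F] (p n : ℕ) : Submodule (ZMod p) (Pt F n → ZMod p) :=
  Submodule.span (ZMod p)
    {v | ∃ W : Submodule F (Fin (n + 1) → F), Module.finrank F W = n ∧ v = incVec p W}

/-- The support of a word. -/
def supp {p n : ℕ} (v : Pt F n → ZMod p) : Set (Pt F n) := {P | v P ≠ 0}

/-- The weight of a word. -/
def wt {p n : ℕ} (v : Pt F n → ZMod p) : ℕ := (supp v).ncard

/-- The weight of the restriction of a word to the subspace determined by `W`. -/
def wtRes {p n : ℕ} (c : Pt F n → ZMod p) (W : Submodule F (Fin (n + 1) → F)) : ℕ :=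
  (ptsIn W ∩ supp c).ncard

/-- `θ_m = (q^(m+1) - 1)/(q - 1)`, with `θ_m = 0` for `m < 0`. -/
def theta (q : ℕ) (m : ℤ) : ℕ :=
  if m < 0 then 0 else ∑ i ∈ Finset.range (m.toNat + 1), q ^ i

/-- The bound `B_{n,q}` from the paper. -/
def B (n q : ℕ) : ℝ :=
  if q < 7 ∨ q = 8 ∨ q = 9 ∨ q = 16 ∨ q = 25 ∨ q = 27 ∨ q = 49 then
    2 * (q : ℝ) ^ (n - 1)
  else if q = 7 ∨ q = 11 ∨ q = 13 ∨ q = 17 then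
    (3 * q - Real.sqrt (6 * q) - 1 / 2) * (q : ℝ) ^ (n - 2)
  else if q = 19 ∨ q = 121 then
    (3 * q - Real.sqrt (6 * q) + 9 / 2) * (q : ℝ) ^ (n - 2)
  else if q = 29 ∨ q = 31 ∨ q = 32 then
    (4 * q - 4 * Real.sqrt q - 25 / 2) * (q : ℝ) ^ (n - 2)
  else
    (4 * q - Real.sqrt (8 * q) - 33 / 2) * (q : ℝ) ^ (n - 2)

/-- A line of `PG(n,q)`: a linear subspace of dimension `2`. -/
def IsLine {n : ℕ} (l : Submodule F (Fin (n + 1) → F)) : Prop := Module.finrank F l = 2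

/-- A plane of `PG(n,q)`: a linear subspace of dimension `3`. -/
def IsPlane {n : ℕ} (W : Submodule F (Fin (n + 1) → F)) : Prop := Module.finrank F W = 3

/-- The line `l` is an `α`-secant to `supp c`. -/
def secant {p n : ℕ} (c : Pt F n → ZMod p) (l : Submodule F (Fin (n + 1) → F)) (α : ℕ) : Prop :=
  IsLine l ∧ (ptsIn l ∩ supp c).ncard = α

/-- The restriction of `c` to the plane `W` is a linear combination of at most two lines of `W`. -/
def TwoLineComb (p : ℕ) {n : ℕ} (c : Pt F n → ZMod p) (W : Submodule F (Fin (n + 1) → F)) :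
    Prop :=
  ∃ l₁ l₂ : Submodule F (Fin (n + 1) → F), IsLine l₁ ∧ IsLine l₂ ∧ l₁ ≤ W ∧ l₂ ≤ W ∧
    ∃ a b : ZMod p, ∀ P : Pt F n, ptIn P W → c P = a * incVec p l₁ P + b * incVec p l₂ P

/-- Type `T^△`: the restriction of `c` to the plane `W` is a linear combination (with nonzero
coefficients) of three nonconcurrent lines of `W`. -/
def TypeTri (p : ℕ) {n : ℕ} (c : Pt F n → ZMod p) (W : Submodule F (Fin (n + 1) → F)) : Prop :=
  ∃ l₁ l₂ l₃ : Submodule F (Fin (n + 1) → F),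
    IsLine l₁ ∧ IsLine l₂ ∧ IsLine l₃ ∧ l₁ ≤ W ∧ l₂ ≤ W ∧ l₃ ≤ W ∧
    l₁ ≠ l₂ ∧ l₁ ≠ l₃ ∧ l₂ ≠ l₃ ∧
    (¬ ∃ P : Pt F n, ptIn P l₁ ∧ ptIn P l₂ ∧ ptIn P l₃) ∧
    ∃ a₁ a₂ a₃ : ZMod p, a₁ ≠ 0 ∧ a₂ ≠ 0 ∧ a₃ ≠ 0 ∧
      ∀ P : Pt F n, ptIn P W →
        c P = a₁ * incVec p l₁ P + a₂ * incVec p l₂ P + a₃ * incVec p l₃ P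

/-- Type `T^★`: the restriction of `c` to the plane `W` is a linear combination (with nonzero
coefficients) of three distinct concurrent lines of `W`. -/
def TypeStar (p : ℕ) {n : ℕ} (c : Pt F n → ZMod p) (W : Submodule F (Fin (n + 1) → F)) : Prop :=
  ∃ l₁ l₂ l₃ : Submodule F (Fin (n + 1) → F),
    IsLine l₁ ∧ IsLine l₂ ∧ IsLine l₃ ∧ l₁ ≤ W ∧ l₂ ≤ W ∧ l₃ ≤ W ∧
    l₁ ≠ l₂ ∧ l₁ ≠ l₃ ∧ l₂ ≠ l₃ ∧
    (∃ P : Pt F n, ptIn P l₁ ∧ ptIn P l₂ ∧ ptIn P l₃) ∧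
    ∃ a₁ a₂ a₃ : ZMod p, a₁ ≠ 0 ∧ a₂ ≠ 0 ∧ a₃ ≠ 0 ∧
      ∀ P : Pt F n, ptIn P W →
        c P = a₁ * incVec p l₁ P + a₂ * incVec p l₂ P + a₃ * incVec p l₃ P

/-- The base code word `c₀` of the `T^odd` construction on `PG(2,p)`:
`c₀(0,1,a) = a`, `c₀(1,0,b) = b`, `c₀(1,1,c) = -c`, and `c₀ = 0` elsewhere. -/
def oddBase (p : ℕ) [Fact p.Prime] : Pt (ZMod p) 2 → ZMod p := fun P =>
  if P.rep 0 = 0 ∧ P.rep 1 ≠ 0 then P.rep 2 / P.rep 1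
  else if P.rep 1 = 0 ∧ P.rep 0 ≠ 0 then P.rep 2 / P.rep 0
  else if P.rep 0 = P.rep 1 ∧ P.rep 0 ≠ 0 then -(P.rep 2 / P.rep 0)
  else 0

/-- The line `m : X₀ = 0` of `PG(2,p)`. -/
def lineM1 (p : ℕ) [Fact p.Prime] : Submodule (ZMod p) (Fin 3 → ZMod p) :=
  LinearMap.ker (LinearMap.proj 0 : (Fin 3 → ZMod p) →ₗ[ZMod p] ZMod p)

/-- The line `m' : X₁ = 0` of `PG(2,p)`. -/
def lineM2 (p : ℕ) [Fact p.Prime] : Submodule (ZMod p) (Fin 3 → ZMod p) :=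
  LinearMap.ker (LinearMap.proj 1 : (Fin 3 → ZMod p) →ₗ[ZMod p] ZMod p)

/-- The line `m'' : X₀ = X₁` of `PG(2,p)`. -/
def lineM3 (p : ℕ) [Fact p.Prime] : Submodule (ZMod p) (Fin 3 → ZMod p) :=
  LinearMap.ker ((LinearMap.proj 0 : (Fin 3 → ZMod p) →ₗ[ZMod p] ZMod p) - LinearMap.proj 1)

/-- The code word `d = (γ c₀ + λ m + λ' m' + λ'' m'')^π` of the `T^odd` construction, where the
collineation `π` of `PG(2,p)` is the inverse of the homography induced by the linear
equivalence `g`. -/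
def oddWord (p : ℕ) [Fact p.Prime] (g : (Fin 3 → ZMod p) ≃ₗ[ZMod p] (Fin 3 → ZMod p))
    (γ lam lam' lam'' : ZMod p) : Pt (ZMod p) 2 → ZMod p := fun P =>
  γ * oddBase p (Projectivization.map g.toLinearMap g.injective P) +
    lam * incVec p (lineM1 p) (Projectivization.map g.toLinearMap g.injective P) +
    lam' * incVec p (lineM2 p) (Projectivization.map g.toLinearMap g.injective P) +
    lam'' * incVec p (lineM3 p) (Projectivization.map g.toLinearMap g.injective P)

/-- The semilinear embedding of `PG(2,p)` onto the plane of `PG(n,q)` spanned by the linearly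
independent vectors `b 0, b 1, b 2`, relative to the field embedding `σ : F_p → F`. -/
def planeEmbed {n : ℕ} {p : ℕ} [Fact p.Prime] (σ : ZMod p →+* F)
    (b : Fin 3 → (Fin (n + 1) → F)) (hb : LinearIndependent F b) :
    Pt (ZMod p) 2 → Pt F n := fun P =>
  Projectivization.mk F (∑ i, σ (P.rep i) • b i) (by
    intro hzero
    have h0 : ∀ i ∈ Finset.univ, σ (P.rep i) = 0 :=
      linearIndependent_iff'.mp hb Finset.univ (fun i => σ (P.rep i)) hzero
    have h1 : P.rep = 0 := funext fun i => σ.injective (by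
      simp only [Pi.zero_apply, map_zero]; exact h0 i (Finset.mem_univ i))
    exact P.rep_nonzero h1)

/-- Type `T^odd`: this requires `q = p` to be prime (`|F| = p`), and `c` restricted to the plane
`W` (spanned by the frame `b`) must coincide, via a semilinear identification of `W` with
`PG(2,p)`, with a code word `d` of the `T^odd` construction. -/
def TypeOdd (p : ℕ) [Fact p.Prime] [Fintype F] {n : ℕ} (c : Pt F n → ZMod p)
    (W : Submodule F (Fin (n + 1) → F)) : Prop :=
  Fintype.card F = p ∧
  ∃ (σ : ZMod p →+* F) (b : Fin 3 → (Fin (n + 1) → F)) (hb : LinearIndependent F b),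
    Submodule.span F (Set.range b) = W ∧
    ∃ (g : (Fin 3 → ZMod p) ≃ₗ[ZMod p] (Fin 3 → ZMod p)) (γ lam lam' lam'' : ZMod p), γ ≠ 0 ∧
      ∀ Q : Pt (ZMod p) 2, c (planeEmbed σ b hb Q) = oddWord p g γ lam lam' lam'' Q

/-- The list of plane types `T_0, T_{q+1}, T_{2q}, T_{2q+1}, T^odd, T^△, T^★`. -/
inductive PlaneT : Type where
  | T0 | Tq1 | T2q | T2q1 | Todd | Ttri | Tstar
deriving DecidableEq

/-- The restriction of `c` to the plane `W` is a code word of the given type. -/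
def PlaneIsType (p q : ℕ) [Fact p.Prime] [Fintype F] {n : ℕ} (c : Pt F n → ZMod p)
    (W : Submodule F (Fin (n + 1) → F)) : PlaneT → Prop
  | .T0 => TwoLineComb p c W ∧ wtRes c W = 0
  | .Tq1 => TwoLineComb p c W ∧ wtRes c W = q + 1
  | .T2q => TwoLineComb p c W ∧ wtRes c W = 2 * q
  | .T2q1 => TwoLineComb p c W ∧ wtRes c W = 2 * q + 1
  | .Todd => TypeOdd p c W
  | .Ttri => TypeTri p c W
  | .Tstar => TypeStar p c W

/-- The plane `W` is of type `𝒯`. -/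
def TypeT (p q : ℕ) [Fact p.Prime] [Fintype F] {n : ℕ} (c : Pt F n → ZMod p)
    (W : Submodule F (Fin (n + 1) → F)) : Prop :=
  IsPlane W ∧ ∃ t : PlaneT, PlaneIsType p q c W t

/-- The plane `W` is of type `𝒪`. -/
def TypeO (p q : ℕ) [Fact p.Prime] [Fintype F] {n : ℕ} (c : Pt F n → ZMod p)
    (W : Submodule F (Fin (n + 1) → F)) : Prop :=
  IsPlane W ∧ ¬ TypeT p q c W

/-- The restriction of `c` to the `k`-space `Sp` (linear dimension `k+1`) is of type `t`:
there is a `(k-3)`-space `κ ⊆ Sp` on which `c` is a scalar multiple of the all-one function,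
a plane `π ⊆ Sp` of type `t` disjoint from `κ`, and `c P = c (⟨κ, P⟩ ∩ π)` for every point
`P` of `Sp` outside `κ`. -/
def SpaceIsType (p q : ℕ) [Fact p.Prime] [Fintype F] {n : ℕ} (c : Pt F n → ZMod p)
    (Sp : Submodule F (Fin (n + 1) → F)) (k : ℕ) (t : PlaneT) : Prop :=
  Module.finrank F Sp = k + 1 ∧
  ∃ κ : Submodule F (Fin (n + 1) → F), Module.finrank F κ = k - 2 ∧ κ ≤ Sp ∧
    (∃ a : ZMod p, ∀ P : Pt F n, ptIn P κ → c P = a) ∧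
    ∃ π : Submodule F (Fin (n + 1) → F), IsPlane π ∧ π ≤ Sp ∧ π ⊓ κ = ⊥ ∧
      PlaneIsType p q c π t ∧
      ∀ P : Pt F n, ptIn P Sp → ¬ ptIn P κ →
        ∃ Q : Pt F n, ptIn Q π ∧
          Projectivization.submodule Q ≤ κ ⊔ Projectivization.submodule P ∧ c P = c Q


/-- A cone `D` such that all but at most two points of the affine line `A + F • B` lie in `D`
whenever `A, B ∈ D`. -/
structure NearSubspace {V : Type*} [AddCommGroup V] [Module F V] (D : Set V) : Prop where
  zero_mem : (0 : V) ∈ D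
  smul_mem : ∀ (c : F) {v : V}, v ∈ D → c • v ∈ D
  line : ∀ {A B : V}, A ∈ D → B ∈ D → {c : F | A + c • B ∉ D}.ncard ≤ 2

section Counting

variable {V : Type*} [AddCommGroup V] [Module F V]

/-- Counting a set along the lines parallel to `R`, indexed by a complementary hyperplane. -/
lemma ncard_eq_sum_fibers [Finite F] [Finite V] {f : Module.Dual F V} {R : V} (hR : f R ≠ 0)
    (S : Set V) [Fintype (LinearMap.ker f)] :
    S.ncard = ∑ y : LinearMap.ker f, {c : F | (y : V) + c • R ∈ S}.ncard := by
  have e : Function.Bijective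
      (fun z : (Σ y : LinearMap.ker f, {c : F | (y : V) + c • R ∈ S}) =>
        (⟨(z.1 : V) + (z.2 : F) • R, z.2.2⟩ : S)) := by
    constructor
    · rintro ⟨⟨y, hy⟩, c, hc⟩ ⟨⟨y', hy'⟩, c', hc'⟩ h
      simp only [Subtype.mk.injEq] at h
      rw [LinearMap.mem_ker] at hy hy'
      have h2 : c = c' := by
        have := congrArg f h
        simp only [map_add, map_smul, hy, hy', zero_add, smul_eq_mul] at this
        exact mul_right_cancel₀ hR this
      subst h2
      have h3 : y = y' := by simpa using h
      subst h3
      rfl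
    · rintro ⟨v, hv⟩
      have hk : v - (f v / f R) • R ∈ LinearMap.ker f := by
        simp [LinearMap.mem_ker, hR]
      exact ⟨⟨⟨_, hk⟩, ⟨f v / f R, by simpa using hv⟩⟩, by simp⟩
  rw [← Nat.card_coe_set_eq, ← Nat.card_congr (Equiv.ofBijective _ e), Nat.card_sigma]
  simp only [Nat.card_coe_set_eq]

lemma card_ker_dual [Finite F] [FiniteDimensional F V] {d : ℕ}
    (hd : Module.finrank F V = d + 1) {f : Module.Dual F V} (hf : f ≠ 0) :
    Nat.card (LinearMap.ker f) = Nat.card F ^ d := by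
  have h := Module.Dual.finrank_ker_add_one_of_ne_zero hf
  rw [Module.natCard_eq_pow_finrank (K := F)]
  congr 1
  omega

lemma sum_ncard_inter_ker [Finite F] [Finite V] [Fintype (Module.Dual F V)] {d : ℕ}
    (hd : Module.finrank F V = d + 1) {S : Set V} (hS : (0 : V) ∉ S) :
    ∑ f : Module.Dual F V, {v | v ∈ S ∧ f v = 0}.ncard = S.ncard * Nat.card F ^ d := by
  have : Fintype V := Fintype.ofFinite V
  have h1 : ∀ f : Module.Dual F V, {v | v ∈ S ∧ f v = 0}.ncard
      = (S.toFinset.filter (fun v => f v = 0)).card := fun f => by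
    rw [← Set.ncard_coe_finset]; congr 1; ext; simp
  simp_rw [h1, Finset.card_filter]
  rw [Finset.sum_comm]
  have h2 : ∀ v ∈ S.toFinset,
      ∑ f : Module.Dual F V, (if f v = 0 then 1 else 0) = Nat.card F ^ d := by
    intro v hv
    have hv0 : v ≠ 0 := by rintro rfl; exact hS (by simpa using hv)
    have hne : Module.Dual.eval F V v ≠ 0 := fun h =>
      hv0 ((Module.forall_dual_apply_eq_zero_iff F v).1 fun f => LinearMap.congr_fun h f)
    rw [← card_ker_dual (d := d) (by rw [Subspace.dual_finrank_eq, hd]) hne,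
      ← Finset.card_filter]
    change _ = Nat.card {f : Module.Dual F V // f v = 0}
    rw [Nat.card_eq_fintype_card, Fintype.card_subtype]
  rw [Finset.sum_congr rfl h2, Finset.sum_const, smul_eq_mul, Set.ncard_eq_toFinset_card']

namespace NearSubspace

variable {D : Set V}

lemma smul_mem_iff (hD : NearSubspace (F := F) D) {c : F} (hc : c ≠ 0) {v : V} :
    c • v ∈ D ↔ v ∈ D :=
  ⟨fun h => by simpa [smul_smul, hc] using hD.smul_mem c⁻¹ h, hD.smul_mem c⟩

lemma comap {W : Type*} [AddCommGroup W] [Module F W] (hD : NearSubspace (F := F) D)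
    (φ : W →ₗ[F] V) : NearSubspace (F := F) (φ ⁻¹' D) where
  zero_mem := by simpa using hD.zero_mem
  smul_mem c v hv := by simpa using hD.smul_mem c hv
  line hA hB := by simpa using hD.line hA hB

/-- Projecting `D` from the point spanned by `P`. -/
lemma project [Finite F] (hD : NearSubspace (F := F) D) (K : Submodule F V) (P : V) :
    NearSubspace (F := F) {y : K | ∃ c : F, (y : V) + c • P ∈ D} where
  zero_mem := ⟨0, by simpa using hD.zero_mem⟩
  smul_mem := by
    rintro c v ⟨t, ht⟩
    exact ⟨c * t, by simpa [smul_smul] using hD.smul_mem c ht⟩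
  line := by
    rintro A B ⟨a, ha⟩ ⟨b, hb⟩
    refine (Set.ncard_le_ncard (fun c hc => ?_) (Set.toFinite _)).trans (hD.line ha hb)
    intro h
    refine hc ⟨a + c * b, ?_⟩
    convert h using 1
    simp only [Submodule.coe_add, Submodule.coe_smul]
    module

lemma line_contra [Finite F] (hD : NearSubspace (F := F) D) {A B : V} (hA : A ∈ D) (hB : B ∈ D)
    {x y z : F} (hx : A + x • B ∉ D) (hy : A + y • B ∉ D) (hz : A + z • B ∉ D)
    (hxy : x ≠ y) (hxz : x ≠ z) (hyz : y ≠ z) : False := by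
  have h := hD.line hA hB
  have h3 : ({x, y, z} : Set F).ncard = 3 := Set.ncard_eq_three.2 ⟨x, y, z, hxy, hxz, hyz, rfl⟩
  have h4 : ({x, y, z} : Set F) ⊆ {c : F | A + c • B ∉ D} := by
    rintro c (rfl | rfl | rfl) <;> assumption
  have := Set.ncard_le_ncard h4 (Set.toFinite _)
  omega

/-- A line with three points outside `D` has at most one point in `D`. -/
lemma eq_of_mem_of_mem [Finite F] (hD : NearSubspace (F := F) D) {R y : V} {e c c' : F}
    (hR : R ∉ D) (hy : y ∉ D) (he : e ≠ 0) (hye : y + e • R ∉ D)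
    (hc : y + c • R ∈ D) (hc' : y + c' • R ∈ D) : c = c' := by
  by_contra hne
  have hc0 : c ≠ 0 := by rintro rfl; simp at hc; exact hy hc
  have hc0' : c' ≠ 0 := by rintro rfl; simp at hc'; exact hy hc'
  have hce : e - c ≠ 0 := by intro h; rw [← sub_eq_zero.1 h] at hc; exact hye hc
  have hce' : e - c' ≠ 0 := by intro h; rw [← sub_eq_zero.1 h] at hc'; exact hye hc'
  have hcc : c - c' ≠ 0 := sub_ne_zero.2 hne
  refine hD.line_contra hc hc' (x := -1) (y := -(c / c')) (z := -((e - c) / (e - c')))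
    ?_ ?_ ?_ ?_ ?_ ?_
  · have : y + c • R + (-1 : F) • (y + c' • R) = (c - c') • R := by module
    rwa [this, hD.smul_mem_iff hcc]
  · have : y + c • R + (-(c / c')) • (y + c' • R) = ((c' - c) / c') • y := by
      match_scalars <;> field_simp <;> ring
    rwa [this, hD.smul_mem_iff (div_ne_zero (sub_ne_zero.2 (Ne.symm hne)) hc0')]
  · have : y + c • R + (-((e - c) / (e - c'))) • (y + c' • R)
        = ((c - c') / (e - c')) • (y + e • R) := by
      match_scalars <;> field_simp <;> ring
    rwa [this, hD.smul_mem_iff (div_ne_zero hcc hce')]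
  · rw [Ne, neg_inj, eq_comm, div_eq_one_iff_eq hc0']; exact hne
  · rw [Ne, neg_inj, eq_comm, div_eq_one_iff_eq hce', sub_right_inj]; exact hne
  · rw [Ne, neg_inj, div_eq_div_iff hc0' hce']
    intro h
    have : e * (c - c') = 0 := by linear_combination h
    exact (mul_ne_zero he hcc) this

/-- The bound coming from projecting from a nonzero point of `D`. -/
lemma ncard_compl_le [Finite F] [Finite V] (hD : NearSubspace (F := F) D) {d : ℕ}
    (hd : Module.finrank F V = d + 1) {f : Module.Dual F V} {P : V} (hf : f P ≠ 0) (hP : P ∈ D) :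
    Dᶜ.ncard + 2 + 2 * {y : LinearMap.ker f | ∃ c : F, (y : V) + c • P ∈ D}ᶜ.ncard
      ≤ 2 * Nat.card F ^ d +
        Nat.card F * {y : LinearMap.ker f | ∃ c : F, (y : V) + c • P ∈ D}ᶜ.ncard := by
  have : Fintype (LinearMap.ker f) := Fintype.ofFinite _
  set T := {y : LinearMap.ker f | ∃ c : F, (y : V) + c • P ∈ D}
  have hf0 : f ≠ 0 := by rintro rfl; simp at hf
  have hsum : Dᶜ.ncard = ∑ y : LinearMap.ker f, {c : F | (y : V) + c • P ∉ D}.ncard :=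
    ncard_eq_sum_fibers hf _
  have hb : ∀ y : LinearMap.ker f, {c : F | (y : V) + c • P ∉ D}.ncard
      + (if y = 0 then 2 else 0) + 2 * (if y ∈ Tᶜ then 1 else 0)
      ≤ 2 + Nat.card F * (if y ∈ Tᶜ then 1 else 0) := by
    intro y
    by_cases hy : y ∈ T
    · simp only [Set.mem_compl_iff, hy, not_true_eq_false, if_false, mul_zero, add_zero]
      split_ifs with h0
      · subst h0
        have : {c : F | ((0 : LinearMap.ker f) : V) + c • P ∉ D} = ∅ := by
          ext c; simpa using hD.smul_mem c hP
        rw [this]; simp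
      · obtain ⟨t, ht⟩ := hy
        have hinj : {c : F | (y : V) + c • P ∉ D}.ncard
            = {c : F | ((y : V) + t • P) + c • P ∉ D}.ncard := by
          rw [← Set.ncard_image_of_injective {c : F | ((y : V) + t • P) + c • P ∉ D}
            (add_right_injective t)]
          congr 1
          ext c
          constructor
          · intro h
            refine ⟨c - t, ?_, by ring⟩
            simpa [sub_smul] using h
          · rintro ⟨s, hs, rfl⟩
            simpa [add_smul, add_assoc] using hs
        rw [hinj]
        exact hD.line ht hP
    · have hy0 : y ≠ 0 := by rintro rfl; exact hy ⟨0, by simpa using hD.zero_mem⟩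
      have := Set.ncard_le_card {c : F | (y : V) + c • P ∉ D}
      simp only [Set.mem_compl_iff, hy, hy0, not_false_eq_true, if_true, if_false]
      omega
  have hs := Finset.sum_le_sum fun y (_ : y ∈ Finset.univ) => hb y
  have hTc : Tᶜ.ncard = ∑ y : LinearMap.ker f, if y ∈ Tᶜ then 1 else 0 := by
    rw [Set.ncard_eq_toFinset_card', ← Finset.card_filter]; congr 1; ext; simp
  simp only [Finset.sum_add_distrib, ← Finset.mul_sum, ← hTc] at hs
  rw [← card_ker_dual hd hf0, Nat.card_eq_fintype_card (α := LinearMap.ker f)]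
  simp at hs
  omega

/-- The bound coming from two hyperplanes `ker f₁`, `ker f₂` in which `D` is small, seen from a
point `R` outside `D` and both hyperplanes. -/
lemma le_ncard_compl [Finite F] [Finite V] (hD : NearSubspace (F := F) D) {d : ℕ}
    (hd : Module.finrank F V = d + 2) {f₁ f₂ g₁ g₂ : Module.Dual F V} {R y₁ y₂ z : V}
    (hR : R ∉ D) (hR₁ : f₁ R ≠ 0) (hR₂ : f₂ R ≠ 0) (hz₁ : f₁ z = 0) (hz₂ : f₂ z ≠ 0)
    (hy₁ : f₁ y₁ = 0) (hgy₁ : g₁ y₁ ≠ 0) (hy₂ : f₂ y₂ = 0) (hgy₂ : g₂ y₂ ≠ 0)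
    (hg₁ : ∀ y ∈ D, f₁ y = 0 → g₁ y = 0) (hg₂ : ∀ y ∈ D, f₂ y = 0 → g₂ y = 0) :
    (Nat.card F - 1) * (Nat.card F ^ (d + 1) + 3)
      ≤ Dᶜ.ncard + (Nat.card F - 1) * (3 * Nat.card F ^ d) := by
  have : Fintype (LinearMap.ker f₁) := Fintype.ofFinite _
  have hf₁ : f₁ ≠ 0 := by rintro rfl; simp at hR₁
  have hK : Module.finrank F (LinearMap.ker f₁) = d + 1 := by
    have := Module.Dual.finrank_ker_add_one_of_ne_zero hf₁; omega
  set h : Module.Dual F V := g₂ - (g₂ R / f₂ R) • f₂ with hh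
  let G : Set (LinearMap.ker f₁) := {y | y = 0 ∨ (g₁ y ≠ 0 ∧ f₂ y ≠ 0 ∧ h y ≠ 0)}
  have hGc : Nat.card F ^ (d + 1) + 3 ≤ G.ncard + 3 * Nat.card F ^ d := by
    have hzero : ∀ (g : Module.Dual F V) (y : V), f₁ y = 0 → g y ≠ 0 →
        {y : LinearMap.ker f₁ | y ≠ 0 ∧ g y = 0}.ncard + 1 = Nat.card F ^ d := by
      intro g y hy hgy
      have hne : g ∘ₗ (LinearMap.ker f₁).subtype ≠ 0 := fun h0 =>
        hgy (by simpa using LinearMap.congr_fun h0 ⟨y, hy⟩)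
      rw [← card_ker_dual hK hne]
      have hset : {y : LinearMap.ker f₁ | y ≠ 0 ∧ g y = 0}
          = (LinearMap.ker (g ∘ₗ (LinearMap.ker f₁).subtype) : Set _) \ {0} := by
        ext; simp [and_comm]
      rw [hset, Set.ncard_sdiff_singleton_add_one (by simp) (Set.toFinite _),
        ← Nat.card_coe_set_eq]
      rfl
    have hhy : h (y₂ - (f₁ y₂ / f₁ R) • R) ≠ 0 := by
      simp only [hh, LinearMap.sub_apply, LinearMap.smul_apply, map_sub, map_smul, smul_eq_mul,
        hy₂]
      convert hgy₂ using 1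
      field_simp
      ring
    have h1 := hzero g₁ y₁ hy₁ hgy₁
    have h2 := hzero f₂ z hz₁ hz₂
    have h3 := hzero h _ (by simp [hR₁]) hhy
    have hcov : (Set.univ : Set (LinearMap.ker f₁)) ⊆ G ∪ ({y | y ≠ 0 ∧ g₁ y = 0} ∪
        ({y | y ≠ 0 ∧ f₂ y = 0} ∪ {y | y ≠ 0 ∧ h y = 0})) := by
      intro y _
      simp only [G, Set.mem_union, Set.mem_ofPred_eq]
      tauto
    have h4 := Set.ncard_le_ncard hcov (Set.toFinite _)
    have h5 := Set.ncard_union_le G ({y | y ≠ 0 ∧ g₁ y = 0} ∪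
        ({y | y ≠ 0 ∧ f₂ y = 0} ∪ {y | y ≠ 0 ∧ h y = 0}))
    have h6 := Set.ncard_union_le {y : LinearMap.ker f₁ | y ≠ 0 ∧ g₁ y = 0}
        ({y | y ≠ 0 ∧ f₂ y = 0} ∪ {y | y ≠ 0 ∧ h y = 0})
    have h7 := Set.ncard_union_le {y : LinearMap.ker f₁ | y ≠ 0 ∧ f₂ y = 0} {y | y ≠ 0 ∧ h y = 0}
    rw [Set.ncard_univ, Module.natCard_eq_pow_finrank (K := F), hK] at h4
    omega
  have hfib : ∀ y ∈ G, Nat.card F - 1 ≤ {c : F | (y : V) + c • R ∉ D}.ncard := by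
    intro y hy
    have h1 := Set.ncard_add_ncard_compl {c : F | (y : V) + c • R ∉ D}
    have h2 : {c : F | (y : V) + c • R ∉ D}ᶜ.ncard ≤ 1 := by
      rw [Set.ncard_le_one (Set.toFinite _)]
      simp only [Set.mem_compl_iff, Set.mem_ofPred_eq, not_not]
      intro c hc c' hc'
      rcases hy with rfl | ⟨hy1, hy2, hy3⟩
      · have key : ∀ c : F, ((0 : LinearMap.ker f₁) : V) + c • R ∈ D → c = 0 := by
          intro c hc
          by_contra h0
          rw [Submodule.coe_zero, zero_add, hD.smul_mem_iff h0] at hc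
          exact hR hc
        rw [key c hc, key c' hc']
      · refine hD.eq_of_mem_of_mem (e := -(f₂ y / f₂ R)) hR (fun h0 => hy1 (hg₁ _ h0 y.2))
          (neg_ne_zero.2 (div_ne_zero hy2 hR₂)) (fun h0 => hy3 ?_) hc hc'
        have := hg₂ _ h0 (by simp [hR₂])
        rw [← this]
        simp only [hh, LinearMap.sub_apply, LinearMap.smul_apply, map_add, map_smul, smul_eq_mul]
        ring
    omega
  have hsum : (Nat.card F - 1) * G.ncard ≤ Dᶜ.ncard := by
    rw [ncard_eq_sum_fibers hR₁, Set.ncard_eq_toFinset_card', mul_comm, ← smul_eq_mul]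
    exact (Finset.card_nsmul_le_sum _ _ _ fun y hy => hfib y (by simpa using hy)).trans
      (Finset.sum_le_sum_of_subset (Finset.subset_univ _))
  have := Nat.mul_le_mul_left (Nat.card F - 1) hGc
  rw [mul_add _ G.ncard] at this
  omega

/-- If `D` is small in no two different hyperplanes, then its complement is small. -/
lemma exists_two_hyperplanes [Finite F] [Finite V] [Nontrivial V] (hD : (0 : V) ∈ D) {d A : ℕ}
    (hd0 : d ≠ 0) (hd : Module.finrank F V = d + 1) (hA : Nat.card F * (A + 1) ≤ Dᶜ.ncard)
    (full : Module.Dual F V → Prop)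
    (hfull : ∀ f : Module.Dual F V, f ≠ 0 → full f ∨ {v | v ∈ Dᶜ ∧ f v = 0}.ncard ≤ A) :
    ∃ f₁ f₂ : Module.Dual F V, f₁ ≠ 0 ∧ full f₁ ∧ full f₂ ∧ f₂ ∉ Submodule.span F {f₁} := by
  by_contra! hcon
  obtain ⟨f₀, hf₀, hsp⟩ : ∃ f₀ : Module.Dual F V, f₀ ≠ 0 ∧
      ∀ f ∉ Submodule.span F {f₀}, {v | v ∈ Dᶜ ∧ f v = 0}.ncard ≤ A := by
    by_cases hex : ∃ f₀ : Module.Dual F V, f₀ ≠ 0 ∧ full f₀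
    · obtain ⟨f₀, h1, h2⟩ := hex
      refine ⟨f₀, h1, fun f hf => (hfull f ?_).resolve_left fun h => hf (hcon f₀ f h1 h2 h)⟩
      rintro rfl
      exact hf (Submodule.zero_mem _)
    · push Not at hex
      obtain ⟨f₀, h1⟩ := exists_ne (0 : Module.Dual F V)
      refine ⟨f₀, h1, fun f hf => (hfull f ?_).resolve_left (hex f ?_)⟩ <;>
      · rintro rfl
        exact hf (Submodule.zero_mem _)
  have : Finite (Module.Dual F V) := Module.finite_of_finite F
  have : Fintype (Module.Dual F V) := Fintype.ofFinite _
  set q := Nat.card F with hq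
  have hs := sum_ncard_inter_ker hd (S := Dᶜ) (by simpa using hD)
  rw [← hq] at hs
  have hX : (Finset.univ.filter (· ∈ Submodule.span F {f₀})).card = q := by
    rw [← Fintype.card_subtype, ← Nat.card_eq_fintype_card]
    rw [Module.natCard_eq_pow_finrank (K := F), finrank_span_singleton hf₀, pow_one]
  have hY : (Finset.univ.filter (· ∈ Submodule.span F {f₀})).card
      + (Finset.univ.filter (· ∉ Submodule.span F {f₀})).card = q ^ (d + 1) := by
    rw [Finset.card_filter_add_card_filter_not, Finset.card_univ, ← Nat.card_eq_fintype_card,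
      Module.natCard_eq_pow_finrank (K := F), Subspace.dual_finrank_eq, hd]
  rw [← Finset.sum_filter_add_sum_filter_not _ (· ∈ Submodule.span F {f₀}),
    ← Finset.add_sum_erase _ _ (a := 0) (by simp)] at hs
  have h0 : {v | v ∈ Dᶜ ∧ (0 : Module.Dual F V) v = 0}.ncard = Dᶜ.ncard := by simp; rfl
  have h1 : ∑ f ∈ (Finset.univ.filter (· ∈ Submodule.span F {f₀})).erase 0,
      {v | v ∈ Dᶜ ∧ f v = 0}.ncard ≤ (q - 1) * (q ^ d - 1) := by
    have hX' : ((Finset.univ.filter (· ∈ Submodule.span F {f₀})).erase 0).card = q - 1 := by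
      rw [Finset.card_erase_of_mem (by simp), hX]
    rw [← hX', ← smul_eq_mul]
    refine Finset.sum_le_card_nsmul _ _ _ fun f hf => ?_
    rw [← card_ker_dual hd (Finset.ne_of_mem_erase hf), ← SetLike.coe_sort_coe, Nat.card_coe_set_eq]
    rw [← Set.ncard_sdiff_singleton_of_mem (a := (0 : V)) (by simp)]
    refine Set.ncard_le_ncard (fun v hv => ⟨hv.2, ?_⟩) (Set.toFinite _)
    rintro rfl
    exact hv.1 hD
  have h2 : ∑ f ∈ Finset.univ.filter (· ∉ Submodule.span F {f₀}),
      {v | v ∈ Dᶜ ∧ f v = 0}.ncard ≤ (q ^ (d + 1) - q) * A := by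
    have : (Finset.univ.filter (· ∉ Submodule.span F {f₀})).card = q ^ (d + 1) - q := by omega
    rw [← this, ← smul_eq_mul]
    exact Finset.sum_le_card_nsmul _ _ _ fun f hf => hsp f (Finset.mem_filter.1 hf).2
  rw [h0] at hs
  have hq1 : 1 < q := Finite.one_lt_card
  have hqd : q ≤ q ^ (d + 1) := Nat.le_self_pow (by omega) q
  have hqd1 : 1 < q ^ d := Nat.one_lt_pow hd0 hq1
  have hle : Dᶜ.ncard * q ^ d ≤ Dᶜ.ncard + (q - 1) * (q ^ d - 1) + (q ^ (d + 1) - q) * A := by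
    omega
  zify [hq1.le, hqd1.le, hqd] at hle hA hqd1
  have hpos : (0 : ℤ) < q ^ d - 1 := by linarith
  have : ((q : ℤ) ^ d - 1) * Dᶜ.ncard ≤ (q ^ d - 1) * (q * A + q - 1) := by
    rw [pow_succ] at hle
    linarith
  have := le_of_mul_le_mul_left this hpos
  linarith

lemma exists_dual_or_ncard_compl_le_of_finrank_eq_two [Finite F] [Finite V]
    (hD : NearSubspace (F := F) D) (hd : Module.finrank F V = 2) :
    (∃ f : Module.Dual F V, f ≠ 0 ∧ ∀ v ∈ D, f v = 0) ∨
      Dᶜ.ncard + 2 ≤ 2 * Nat.card F := by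
  by_cases hdep : ∃ A ∈ D, ∃ B ∈ D, LinearIndependent F ![A, B]
  · right
    obtain ⟨A, hA, B, hB, hAB⟩ := hdep
    have hq1 : 1 < Nat.card F := Finite.one_lt_card
    have hspan : ∀ v : V, ∃ a b : F, a • A + b • B = v := by
      intro v
      have htop := hAB.span_eq_top_of_card_eq_finrank' (by simp [hd])
      have : v ∈ Submodule.span F (Set.range ![A, B]) := by rw [htop]; trivial
      rwa [Matrix.range_cons, Matrix.range_cons, Matrix.range_empty, Set.union_empty,
        Set.singleton_union, Submodule.mem_span_pair] at this
    have hsub : Dᶜ ⊆ (fun x : F × F => x.1 • (A + x.2 • B)) ''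
        ({0}ᶜ ×ˢ {c | A + c • B ∉ D}) := by
      intro v hv
      obtain ⟨a, b, rfl⟩ := hspan v
      have ha : a ≠ 0 := by
        rintro rfl
        exact hv (by simpa using hD.smul_mem b hB)
      have hab : a • (A + (b / a) • B) = a • A + b • B := by
        rw [smul_add, smul_smul, mul_div_cancel₀ _ ha]
      refine ⟨(a, b / a), ⟨ha, fun h => hv ?_⟩, hab⟩
      have := hD.smul_mem a h
      rwa [hab] at this
    have h1 := (Set.ncard_le_ncard hsub (Set.toFinite _)).trans
      (Set.ncard_image_le (Set.toFinite _))
    rw [Set.ncard_prod] at h1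
    have h2 : ({0}ᶜ : Set F).ncard + 1 = Nat.card F := by
      have := Set.ncard_add_ncard_compl ({0} : Set F)
      rw [Set.ncard_singleton] at this
      omega
    have h3 := Nat.mul_le_mul_left ({0}ᶜ : Set F).ncard (hD.line hA hB)
    omega
  · left
    push Not at hdep
    have hne : Submodule.span F D ≠ ⊤ := by
      by_cases h0 : D ⊆ {0}
      · rw [Submodule.span_eq_bot.2 fun v hv => h0 hv]
        intro h
        have := finrank_top F V
        rw [← h, finrank_bot] at this
        omega
      · obtain ⟨A, hA, hA0⟩ := Set.not_subset.1 h0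
        intro h
        have hle : Submodule.span F D ≤ Submodule.span F {A} := by
          rw [Submodule.span_le]
          intro B hB
          have := hdep A hA B hB
          rw [LinearIndependent.pair_iff' hA0] at this
          push Not at this
          exact Submodule.mem_span_singleton.2 this
        have h1 := Submodule.finrank_mono hle
        rw [h, finrank_top, finrank_span_singleton hA0] at h1
        omega
    obtain ⟨f, hf, hfle⟩ := Submodule.exists_le_ker_of_lt_top _ (lt_top_iff_ne_top.2 hne)
    exact ⟨f, hf, fun v hv => hfle (Submodule.subset_span hv)⟩

end NearSubspace

end Counting

/-- A near-subspace is contained in a hyperplane or has a small complement. -/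
theorem NearSubspace.exists_dual_or_ncard_compl_le [Finite F] (hq : 7 ≤ Nat.card F) (m : ℕ) :
    ∀ {V : Type} [AddCommGroup V] [Module F V] [Finite V] {D : Set V},
      NearSubspace (F := F) D → Module.finrank F V = m + 2 →
      (∃ f : Module.Dual F V, f ≠ 0 ∧ ∀ v ∈ D, f v = 0) ∨
        Dᶜ.ncard + 1 + Nat.card F ^ m ≤ 2 * Nat.card F ^ (m + 1) := by
  induction m with
  | zero =>
    intro V _ _ _ D hD hd
    simpa [add_assoc] using hD.exists_dual_or_ncard_compl_le_of_finrank_eq_two hd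
  | succ m ih =>
    intro V _ _ _ D hD hd
    by_contra! hcon
    obtain ⟨hspan, hlarge⟩ := hcon
    set q := Nat.card F with hqdef
    have hq0 : 0 < q ^ m := pow_pos (by omega) _
    have : Nontrivial V := Module.nontrivial_of_finrank_pos (R := F) (by omega)
    have hker : ∀ f : Module.Dual F V, f ≠ 0 → Module.finrank F (LinearMap.ker f) = m + 2 := by
      intro f hf
      have := Module.Dual.finrank_ker_add_one_of_ne_zero hf
      omega
    have hcardker : ∀ f : Module.Dual F V, f ≠ 0 → {v | f v = 0}.ncard = q ^ (m + 2) :=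
      fun f hf => by
        rw [hqdef, ← card_ker_dual (d := m + 2) (by omega) hf]; rfl
    let A := 2 * q ^ (m + 1) - q ^ m - 1
    have hA : A + 1 + q ^ m = 2 * q ^ (m + 1) := by
      have : q ^ m * 7 ≤ q ^ (m + 1) := by rw [pow_succ]; gcongr
      omega
    obtain ⟨f₁, f₂, hf₁, ⟨g₁, ⟨y₁, hy₁, hgy₁⟩, hg₁⟩, ⟨g₂, ⟨y₂, hy₂, hgy₂⟩, hg₂⟩, hf₂⟩ :=
      exists_two_hyperplanes hD.zero_mem (d := m + 2) (A := A) (by omega) hd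
        (by rw [← hqdef]
            have : q * (A + 1 + q ^ m) = q * (2 * q ^ (m + 1)) := by rw [hA]
            have e1 : q * (2 * q ^ (m + 1)) = 2 * q ^ (m + 1 + 1) := by ring
            have e2 : q * (A + 1 + q ^ m) = q * (A + 1) + q ^ (m + 1) := by ring
            omega)
        (fun f => ∃ g : Module.Dual F V, (∃ y, f y = 0 ∧ g y ≠ 0) ∧
          ∀ y ∈ D, f y = 0 → g y = 0)
        (by
          intro f hf
          refine (ih (hD.comap (LinearMap.ker f).subtype) (hker f hf)).imp ?_ ?_
          · rintro ⟨g, hg, hgD⟩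
            obtain ⟨g', hg'⟩ := LinearMap.exists_extend g
            have hg'' : ∀ y : LinearMap.ker f, g' y = g y := fun y => LinearMap.congr_fun hg' y
            obtain ⟨y, hy⟩ := DFunLike.ne_iff.1 hg
            refine ⟨g', ⟨y, y.2, by rwa [hg'']⟩, fun y hy hfy => ?_⟩
            exact (hg'' ⟨y, hfy⟩).trans (hgD ⟨y, hfy⟩ hy)
          · intro h
            have : {v | v ∈ Dᶜ ∧ f v = 0}
                = (LinearMap.ker f).subtype '' ((LinearMap.ker f).subtype ⁻¹' D)ᶜ := by
              ext v
              simp [and_comm]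
            rw [this, Set.ncard_image_of_injective _ (LinearMap.ker f).subtype_injective]
            omega)
    have hf₂0 : f₂ ≠ 0 := by rintro rfl; exact hf₂ (Submodule.zero_mem _)
    obtain ⟨z, hz₁, hz₂⟩ : ∃ z, f₁ z = 0 ∧ f₂ z ≠ 0 := by
      by_contra! h
      refine hf₂ (Submodule.mem_span_singleton.2 ?_)
      obtain ⟨w, hw⟩ := DFunLike.ne_iff.1 hf₁
      simp only [LinearMap.zero_apply] at hw
      refine ⟨f₂ w / f₁ w, LinearMap.ext fun v => ?_⟩
      have := h (v - (f₁ v / f₁ w) • w) (by simp [hw])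
      simp only [map_sub, map_smul, smul_eq_mul, LinearMap.smul_apply] at this ⊢
      linear_combination -this
    obtain ⟨R, hR, hR₁, hR₂⟩ : ∃ R, R ∉ D ∧ f₁ R ≠ 0 ∧ f₂ R ≠ 0 := by
      by_contra! h
      have hint : {v | f₁ v = 0 ∧ f₂ v = 0}.ncard = q ^ (m + 1) := by
        have hne : f₂ ∘ₗ (LinearMap.ker f₁).subtype ≠ 0 := fun h0 =>
          hz₂ (by simpa using LinearMap.congr_fun h0 ⟨z, hz₁⟩)
        rw [hqdef, ← card_ker_dual (hker f₁ hf₁) hne]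
        have : {v | f₁ v = 0 ∧ f₂ v = 0} = (LinearMap.ker f₁).subtype ''
            (LinearMap.ker (f₂ ∘ₗ (LinearMap.ker f₁).subtype) : Set _) := by
          ext v; simp [and_comm]
        rw [this, Set.ncard_image_of_injective _ (LinearMap.ker f₁).subtype_injective]
        rfl
      have hunion := Set.ncard_union_add_ncard_inter {v | f₁ v = 0} {v | f₂ v = 0}
      rw [hcardker f₁ hf₁, hcardker f₂ hf₂0] at hunion
      have hint' : ({v | f₁ v = 0} ∩ {v | f₂ v = 0}).ncard = q ^ (m + 1) := hint
      have hsub : Dᶜ ⊆ ({v | f₁ v = 0} ∪ {v | f₂ v = 0}) \ {0} := by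
        intro v hv
        refine ⟨?_, ?_⟩
        · by_cases h1 : f₁ v = 0
          · exact Or.inl h1
          · exact Or.inr (h v hv h1)
        · rintro rfl
          exact hv hD.zero_mem
      have h1 := Set.ncard_le_ncard hsub (Set.toFinite _)
      have h2 := Set.ncard_sdiff_singleton_add_one
        (show (0 : V) ∈ {v | f₁ v = 0} ∪ {v | f₂ v = 0} by simp) (Set.toFinite _)
      rw [hint'] at hunion
      have e : q ^ (m + 1 + 1) = q ^ (m + 2) := rfl
      omega
    have hlow := hD.le_ncard_compl (d := m + 1) hd hR hR₁ hR₂ hz₁ hz₂ hy₁ hgy₁ hy₂ hgy₂ hg₁ hg₂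
    obtain ⟨P, hP, hP0⟩ : ∃ P ∈ D, P ≠ 0 := by
      by_contra! h
      obtain ⟨v, hv, hv0⟩ := hspan f₁ hf₁
      rw [h v hv, map_zero] at hv0
      exact hv0 rfl
    obtain ⟨f, hfP⟩ : ∃ f : Module.Dual F V, f P ≠ 0 := by
      by_contra! h
      exact hP0 ((Module.forall_dual_apply_eq_zero_iff F P).1 h)
    have hf0 : f ≠ 0 := by rintro rfl; simp at hfP
    have hup := hD.ncard_compl_le (d := m + 2) hd hfP hP
    rcases ih (hD.project (LinearMap.ker f) P) (hker f hf0) with ⟨g, hg, hgD⟩ | h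
    · obtain ⟨g', hg'⟩ := LinearMap.exists_extend g
      have hg'' : ∀ y : LinearMap.ker f, g' y = g y := fun y => LinearMap.congr_fun hg' y
      obtain ⟨y, hy⟩ := DFunLike.ne_iff.1 hg
      obtain ⟨v, hv, hv0⟩ := hspan (g' - (g' P / f P) • f) (by
        refine DFunLike.ne_iff.2 ⟨(y : V), ?_⟩
        have : f y = 0 := y.2
        simpa [this, hg''] using hy)
      refine hv0 ?_
      have hk : v - (f v / f P) • P ∈ LinearMap.ker f := by simp [hfP]
      have h1 := hgD ⟨_, hk⟩ ⟨f v / f P, by simpa using hv⟩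
      rw [← hg''] at h1
      simp only [map_sub, map_smul, smul_eq_mul, LinearMap.sub_apply, LinearMap.smul_apply]
        at h1 ⊢
      linear_combination h1
    · set s := {y : LinearMap.ker f | ∃ c : F, (y : V) + c • P ∈ D}ᶜ.ncard
      clear_value s
      rw [← hqdef] at hup hlow
      generalize Dᶜ.ncard = t at hup hlow
      obtain ⟨r, hr⟩ : ∃ r, q = r + 7 := ⟨q - 7, by omega⟩
      have e1 : q ^ (m + 1) = q ^ m * q := pow_succ _ _
      have e2 : q ^ (m + 2) = q ^ m * q ^ 2 := pow_add _ _ _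
      have e3 : q ^ (m + 1 + 1) = q ^ m * q ^ 2 := pow_add _ m 2
      rw [e1] at h
      rw [e1, e3] at hlow
      rw [e2] at hup
      generalize q ^ m = a at *
      clear_value q
      subst hr
      rw [show r + 7 - 1 = r + 6 by omega] at hlow
      have h3 : (r + 5) * (s + 1 + a) ≤ (r + 5) * (2 * (a * (r + 7))) := Nat.mul_le_mul_left _ h
      zify at *
      have hra : (0 : ℤ) ≤ a * r := by positivity
      have hra2 : (0 : ℤ) ≤ a * r ^ 2 := by positivity
      have hra3 : (0 : ℤ) ≤ a * r ^ 3 := by positivity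
      nlinarith

/-- The vectors that are zero or represent a point outside `S`. -/
def complCone {n : ℕ} (S : Set (Pt F n)) : Set (Fin (n + 1) → F) :=
  {v | ∀ h : v ≠ 0, Projectivization.mk F v h ∉ S}

lemma smul_mem_complCone {n : ℕ} {S : Set (Pt F n)} (c : F) {v : Fin (n + 1) → F}
    (hv : v ∈ complCone S) : c • v ∈ complCone S := by
  intro h
  have hv0 : v ≠ 0 := by rintro rfl; simp at h
  have hc : c ≠ 0 := by rintro rfl; simp at h
  have : Projectivization.mk F (c • v) h = Projectivization.mk F v hv0 :=
    (Projectivization.mk_eq_mk_iff' F _ _ _ _).2 ⟨c, rfl⟩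
  rw [this]
  exact hv hv0

lemma nearSubspace_complCone [Finite F] {n : ℕ} {S : Set (Pt F n)}
    (hline : ∀ l : Submodule F (Fin (n + 1) → F), IsLine l →
      (ptsIn l ∩ S).ncard ≤ 2 ∨ Nat.card F ≤ (ptsIn l ∩ S).ncard) :
    NearSubspace (F := F) (complCone S) where
  zero_mem h := absurd rfl h
  smul_mem := smul_mem_complCone
  line := by
    intro A B hA hB
    by_cases hAB : LinearIndependent F ![A, B]
    · have hne : ∀ c : F, A + c • B ≠ 0 := by
        intro c h
        have := LinearIndependent.pair_iff.1 hAB 1 c (by simpa using h)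
        simp at this
      let φ : F → Pt F n := fun c => Projectivization.mk F (A + c • B) (hne c)
      have hφ : Function.Injective φ := by
        intro c c' h
        obtain ⟨a, ha⟩ := (Projectivization.mk_eq_mk_iff' F _ _ _ _).1 h
        have := LinearIndependent.pair_iff.1 hAB (a - 1) (a * c' - c) (by
          rw [← sub_eq_zero] at ha
          rw [← ha]
          module)
        obtain ⟨h1, h2⟩ := this
        rw [sub_eq_zero.1 h1] at h2
        linear_combination -h2
      have himg : ptsIn (Submodule.span F {A, B}) ∩ S
          = φ '' {c : F | A + c • B ∉ complCone S} := by
        ext P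
        induction P using Projectivization.ind with
        | h v hv =>
          have hmem : Projectivization.mk F v hv ∈ ptsIn (Submodule.span F {A, B}) ↔
              v ∈ Submodule.span F {A, B} := by
            change Projectivization.submodule _ ≤ _ ↔ _
            rw [Projectivization.submodule_mk, Submodule.span_singleton_le_iff_mem]
          rw [Set.mem_inter_iff, hmem]
          constructor
          · rintro ⟨hvs, hvS⟩
            obtain ⟨a, b, rfl⟩ := Submodule.mem_span_pair.1 hvs
            have ha : a ≠ 0 := by
              rintro rfl
              rw [zero_smul, zero_add] at hv
              exact smul_mem_complCone b hB hv (by simpa using hvS)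
            have hab : a • (A + (b / a) • B) = a • A + b • B := by
              rw [smul_add, smul_smul, mul_div_cancel₀ _ ha]
            have heq : φ (b / a) = Projectivization.mk F (a • A + b • B) hv :=
              ((Projectivization.mk_eq_mk_iff' F _ _ _ _).2 ⟨a, hab⟩).symm
            refine ⟨b / a, fun h => h (hne _) ?_, heq⟩
            change φ (b / a) ∈ S
            rwa [heq]
          · rintro ⟨c, hc, hcv⟩
            rw [← hcv]
            refine ⟨?_, ?_⟩
            · obtain ⟨a, ha⟩ := (Projectivization.mk_eq_mk_iff' F _ _ _ _).1 hcv.symm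
              rw [← ha]
              refine Submodule.smul_mem _ _ (Submodule.mem_span_pair.2 ⟨1, c, by simp⟩)
            · by_contra h
              exact hc fun _ => h
      have hl : IsLine (Submodule.span F {A, B}) := by
        have := finrank_span_eq_card hAB
        rw [Matrix.range_cons, Matrix.range_cons, Matrix.range_empty, Set.union_empty,
          Set.singleton_union] at this
        simpa [IsLine] using this
      have h := hline _ hl
      rw [himg, Set.ncard_image_of_injective _ hφ] at h
      refine h.resolve_right fun hcard => ?_
      have hlt : {c : F | A + c • B ∉ complCone S}.ncard < (Set.univ : Set F).ncard :=
        Set.ncard_lt_ncard (Set.ssubset_univ_iff.2 fun huniv => by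
          have : (0 : F) ∈ {c : F | A + c • B ∉ complCone S} := huniv ▸ Set.mem_univ _
          simp at this
          exact this hA) (Set.toFinite _)
      rw [Set.ncard_univ] at hlt
      omega
    · have : {c : F | A + c • B ∉ complCone S} = ∅ := by
        refine Set.eq_empty_iff_forall_notMem.2 fun c hc => hc ?_
        by_cases hA0 : A = 0
        · subst hA0
          simpa using smul_mem_complCone c hB
        · rw [LinearIndependent.pair_iff' hA0] at hAB
          push Not at hAB
          obtain ⟨a, rfl⟩ := hAB
          have : A + c • a • A = (1 + c * a) • A := by module
          rw [this]
          exact smul_mem_complCone _ hA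
      simp [this]

lemma ncard_mul_le_ncard_compl_complCone [Finite F] {n : ℕ} (S : Set (Pt F n)) :
    (Nat.card F - 1) * S.ncard ≤ (complCone S)ᶜ.ncard := by
  have hcard : Nat.card Fˣ = Nat.card F - 1 := Nat.card_units F
  rw [← hcard, mul_comm, ← Nat.card_coe_set_eq, ← Nat.card_coe_set_eq, ← Nat.card_prod]
  have hne : ∀ (P : Pt F n) (c : Fˣ), (c : F) • P.rep ≠ 0 := fun P c =>
    smul_ne_zero c.ne_zero P.rep_nonzero
  have hmk : ∀ (P : Pt F n) (c : Fˣ), Projectivization.mk F ((c : F) • P.rep) (hne P c) = P :=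
    fun P c => by
      conv_rhs => rw [← P.mk_rep]
      exact (Projectivization.mk_eq_mk_iff' F _ _ _ _).2 ⟨c, rfl⟩
  refine Nat.card_le_card_of_injective (fun x : S × Fˣ =>
    (⟨(x.2 : F) • x.1.1.rep, fun h => h (hne _ _) (by rw [hmk]; exact x.1.2)⟩ :
      ((complCone S)ᶜ : Set _))) ?_
  rintro ⟨⟨P, hP⟩, c⟩ ⟨⟨P', hP'⟩, c'⟩ h
  simp only [Subtype.mk.injEq] at h
  have hPP : P = P' := by
    rw [← hmk P c, ← hmk P' c']
    simp only [h]
  subst hPP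
  have hcc : c = c' := Units.ext (smul_left_injective F P.rep_nonzero h)
  rw [hcc]

/-- Lemma 16 of the paper: if every line meets `S` in at most `2` or at least
`q` points, then `|S| ≤ 2q^{n-1} + θ_{n-2}` or the complement of `S` lies in a hyperplane. -/
theorem statement3 [Fintype F] {p h q n : ℕ} [Fact p.Prime] (hh : 1 ≤ h) (hq : q = p ^ h)
    (hF : Fintype.card F = q) (hq7 : 7 ≤ q) (hn : 1 ≤ n)
    (S : Set (Pt F n))
    (hline : ∀ l : Submodule F (Fin (n + 1) → F), IsLine l →
      (ptsIn l ∩ S).ncard ≤ 2 ∨ q ≤ (ptsIn l ∩ S).ncard) :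
    S.ncard ≤ 2 * q ^ (n - 1) + theta q ((n : ℤ) - 2) ∨
      ∃ H : Submodule F (Fin (n + 1) → F), Module.finrank F H = n ∧ Sᶜ ⊆ ptsIn H := by
  have hcardF : Nat.card F = q := by rw [Nat.card_eq_fintype_card, hF]
  obtain ⟨m, rfl⟩ : ∃ m, n = m + 1 := ⟨n - 1, by omega⟩
  have hD := nearSubspace_complCone (S := S) (by rwa [hcardF])
  rcases hD.exists_dual_or_ncard_compl_le (by rwa [hcardF]) m (by simp) with ⟨f, hf, hfD⟩ | h
  · right
    refine ⟨LinearMap.ker f, ?_, fun P hP => ?_⟩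
    · have := Module.Dual.finrank_ker_add_one_of_ne_zero hf
      rw [Module.finrank_fin_fun] at this
      omega
    · change Projectivization.submodule P ≤ LinearMap.ker f
      rw [Projectivization.submodule_eq, Submodule.span_singleton_le_iff_mem, LinearMap.mem_ker]
      exact hfD _ fun _ => by rwa [P.mk_rep]
  · left
    have h1 := ncard_mul_le_ncard_compl_complCone S
    rw [hcardF] at h h1
    have hθ : (q - 1) * theta q (((m + 1 : ℕ) : ℤ) - 2) + 1 = q ^ m := by
      rcases m with _ | k
      · simp [theta]
      · have : ((k + 1 + 1 : ℕ) : ℤ) - 2 = k := by push_cast; ring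
        rw [this, theta, if_neg (by omega), Int.toNat_natCast, mul_comm,
          Nat.geomSum_eq (by omega), Nat.div_mul_cancel (Nat.sub_one_dvd_pow_sub_one q (k + 1))]
        have := Nat.one_le_pow (k + 1) q (by omega)
        omega
    rw [Nat.add_sub_cancel]
    refine Nat.le_of_mul_le_mul_left (c := q - 1) ?_ (by omega)
    rw [mul_add]
    have e : (q - 1) * (2 * q ^ m) + 2 * q ^ m = 2 * q ^ (m + 1) := by
      obtain ⟨r, rfl⟩ : ∃ r, q = r + 1 := ⟨q - 1, by omega⟩
      rw [Nat.add_sub_cancel]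
      ring
    omega

end PGCode
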